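/- arXiv:1610.01408 — 7 statements merged into one kernel-verified Lean document; each statement's English description precedes it below -/
import Mathlib

section
/- Let a, β, μ, ℓ, z be real numbers with a ≠ 0, β ≠ 0 and 1 + ℓz ≠ 0. Set b = a/β³ and m = ℓ + μa, and assume (1+mz)/(1+ℓz) > 0. Then β·(G(a,ℓ,z) + μ·Q(a,ℓ,z)) = (det G(a,ℓ,z) / det G(b,m,z))^{2/3} · G(b,m,z), where the exponent 2/3 denotes the real power of the (positive) ratio of determinants. -/
/-- The matrix `G(a,ℓ,z)` of the metric `g_{a,ℓ}` at a point where `f(x) = z`. -/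
noncomputable def G (a ℓ z : ℝ) : Matrix (Fin 2) (Fin 2) ℝ :=
  a • !![ℓ / (1 + ℓ * z) ^ 2, 1 / (1 + ℓ * z); 1 / (1 + ℓ * z), z / (1 + ℓ * z)]

/-- The matrix `Q(a,ℓ,z)` of the square of the Clairaut integral. -/
noncomputable def Q (a ℓ z : ℝ) : Matrix (Fin 2) (Fin 2) ℝ :=
  (a ^ 2 / (1 + ℓ * z) ^ 2) • !![1, z; z, z ^ 2]

theorem det_G (a ℓ z : ℝ) (h : 1 + ℓ * z ≠ 0) :
    (G a ℓ z).det = -a ^ 2 / (1 + ℓ * z) ^ 3 := by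
  simp only [G, Matrix.det_fin_two, Matrix.smul_apply, Matrix.of_apply, Matrix.cons_val',
    Matrix.cons_val_zero, Matrix.cons_val_one, Matrix.cons_val_fin_one, smul_eq_mul]
  field_simp
  ring

theorem rpow_two_thirds_of_cube {x : ℝ} (hx : 0 ≤ x) : (x ^ 3) ^ ((2 : ℝ) / 3) = x ^ 2 := by
  rw [← Real.rpow_natCast x 3, ← Real.rpow_mul hx, ← Real.rpow_natCast x 2]
  norm_num

theorem matrix_equiv (a β μ ℓ z b m : ℝ) (ha : a ≠ 0) (hβ : β ≠ 0)
    (h : 1 + ℓ * z ≠ 0) (hb : b = a / β ^ 3) (hm : m = ℓ + μ * a)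
    (hpos : (1 + m * z) / (1 + ℓ * z) > 0) :
    β • (G a ℓ z + μ • Q a ℓ z) =
      ((G a ℓ z).det / (G b m z).det) ^ ((2 : ℝ) / 3) • G b m z := by
  have hm0 : 1 + m * z ≠ 0 := fun h0 => by simp [h0] at hpos
  have hdet : (G a ℓ z).det / (G b m z).det =
      (β ^ 2 * ((1 + m * z) / (1 + ℓ * z))) ^ 3 := by
    rw [det_G a ℓ z h, det_G b m z hm0, hb]
    field_simp
  rw [hdet, rpow_two_thirds_of_cube (by positivity)]
  have hm0' : 1 + z * m ≠ 0 := by rwa [mul_comm z m]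
  subst hb
  ext i j
  fin_cases i <;> fin_cases j <;> simp [G, Q] <;> field_simp <;> rw [hm] <;> ring
end

section
/- Let k be a real number and h₁, h₂ : ℝ → ℝ be functions. Then the identity h₁(x) + h₂(y) = h₁(y+k) + h₂(x+k) holds for all real x, y if and only if there exists a constant c ∈ ℝ such that h₂(x+k) = h₁(x) + c for all x and h₁ is 2k-periodic (i.e. h₁(x+2k) = h₁(x) for all x). -/
theorem liouville_isometry_functional_equation (k : ℝ) (h₁ h₂ : ℝ → ℝ) :
    (∀ x y : ℝ, h₁ x + h₂ y = h₁ (y + k) + h₂ (x + k)) ↔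
      ∃ c : ℝ, (∀ x : ℝ, h₂ (x + k) = h₁ x + c) ∧ (∀ x : ℝ, h₁ (x + 2 * k) = h₁ x) := by
  constructor
  · intro h
    refine ⟨h₂ 0 - h₁ k, fun x => ?_, fun x => ?_⟩
    · have hx := h x 0
      rw [zero_add] at hx
      linarith
    · have hx := h x (x + k)
      rw [show x + k + k = x + 2 * k by ring] at hx
      linarith
  · rintro ⟨c, hc, hper⟩ x y
    have hy := hc (y - k)
    have hp := hper (y - k)
    rw [sub_add_cancel] at hy
    rw [show y - k + 2 * k = y + k by ring] at hp
    linarith [hc x]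
end

section
/- Let k be a real number and h₁, h₂ : ℝ → ℝ be functions. Then the identity h₁(x) + h₂(y) = h₁(−y+k) + h₂(−x−k) holds for all real x, y if and only if there exists a constant c ∈ ℝ such that h₂(−x−k) = h₁(x) + c for all x and h₁ is 2k-periodic (i.e. h₁(x+2k) = h₁(x) for all x). -/
theorem liouville_isometry_functional_equation_reflected (k : ℝ) (h₁ h₂ : ℝ → ℝ) :
    (∀ x y : ℝ, h₁ x + h₂ y = h₁ (-y + k) + h₂ (-x - k)) ↔
      ∃ c : ℝ, (∀ x : ℝ, h₂ (-x - k) = h₁ x + c) ∧ (∀ x : ℝ, h₁ (x + 2 * k) = h₁ x) := by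
  constructor
  · intro h
    refine ⟨h₂ 0 - h₁ (-0 + k), fun x => by linarith [h x 0], fun x => ?_⟩
    have hx := h x (-x - k)
    rw [show -(-x - k) + k = x + 2 * k by ring] at hx
    linarith
  · rintro ⟨c, hc, hp⟩ x y
    have hy := hc (-y - k)
    have hper := hp (-y - k)
    rw [show -(-y - k) - k = y by ring] at hy
    rw [show -y - k + 2 * k = -y + k by ring] at hper
    linarith [hc x]
end

section
/- Fix real numbers a > 1 and ε. Let α : ℝ → ℝ be a C^∞ function equal to 1 on a neighbourhood of 0 and equal to a on a neighbourhood of 1, and let λ : ℝ → ℝ be a C^∞ function equal to 0 on a neighbourhood of 0 and equal to ε on a neighbourhood of 1. Define A(x) = α(x − ⌊x⌋) · a^⌊x⌋ and Λ(x) = λ(x − ⌊x⌋) + ε · ((1 − a^{3⌊x⌋})/(1 − a³)) · α(x − ⌊x⌋)³. Then Λ is C^∞ on ℝ and satisfies Λ(x+1) = Λ(x) + ε·A(x)³ for all real x. -/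
/-- A function given by a smooth formula `f n` on each interval `[n, n + 1)` is smooth when
consecutive formulas agree near the integers. -/
theorem contDiff_of_eventuallyEq_floor {E : Type*} [NormedAddCommGroup E] [NormedSpace ℝ E]
    {k : WithTop ℕ∞} {f : ℤ → ℝ → E} {g : ℝ → E} (hf : ∀ n, ContDiff ℝ k (f n))
    (hg : ∀ x, g x = f ⌊x⌋ x) (hglue : ∀ n : ℤ, f (n - 1) =ᶠ[nhds (n : ℝ)] f n) :
    ContDiff ℝ k g := by
  refine contDiff_iff_contDiffAt.2 fun x => ((hf ⌊x⌋).contDiffAt).congr_of_eventuallyEq ?_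
  have hlt : x < ⌊x⌋ + 1 := Int.lt_floor_add_one x
  rcases (Int.floor_le x).eq_or_lt with hx | hx
  · have hev := hglue ⌊x⌋
    rw [hx] at hev
    filter_upwards [hev, Ioo_mem_nhds (show (⌊x⌋ : ℝ) - 1 < x by linarith) hlt] with y hy hmem
    rcases lt_or_ge y ⌊x⌋ with h | h
    · have hfloor : ⌊y⌋ = ⌊x⌋ - 1 :=
        Int.floor_eq_iff.2 ⟨by push_cast; exact hmem.1.le, by push_cast; linarith⟩
      rw [hg, hfloor, hy]
    · rw [hg, Int.floor_eq_iff.2 ⟨h, hmem.2⟩]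
  · filter_upwards [Ioo_mem_nhds hx hlt] with y hy
    rw [hg, Int.floor_eq_iff.2 ⟨hy.1.le, hy.2⟩]


theorem parameter_function_smooth (a ε : ℝ) (ha : 1 < a) (α lam : ℝ → ℝ)
    (hα : ContDiff ℝ (⊤ : ℕ∞) α)
    (hα0 : ∀ᶠ x in nhds (0 : ℝ), α x = 1)
    (hα1 : ∀ᶠ x in nhds (1 : ℝ), α x = a)
    (hlam : ContDiff ℝ (⊤ : ℕ∞) lam)
    (hlam0 : ∀ᶠ x in nhds (0 : ℝ), lam x = 0)
    (hlam1 : ∀ᶠ x in nhds (1 : ℝ), lam x = ε)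
    (A Λ : ℝ → ℝ)
    (hA : ∀ x : ℝ, A x = α (x - ⌊x⌋) * a ^ (⌊x⌋ : ℤ))
    (hΛ : ∀ x : ℝ,
      Λ x = lam (x - ⌊x⌋) + ε * ((1 - a ^ (3 * ⌊x⌋ : ℤ)) / (1 - a ^ 3)) * (α (x - ⌊x⌋)) ^ 3) :
    ContDiff ℝ (⊤ : ℕ∞) Λ ∧ ∀ x : ℝ, Λ (x + 1) = Λ x + ε * (A x) ^ 3 := by
  have ha0 : a ≠ 0 := by positivity
  have hden : 1 - a ^ 3 ≠ 0 := (sub_neg.2 (one_lt_pow₀ ha three_ne_zero)).ne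
  have hpow (n : ℤ) : a ^ (3 * (n + 1)) = a ^ (3 * n) * a ^ 3 := by
    rw [mul_add, zpow_add₀ ha0]
    norm_cast
  constructor
  · refine contDiff_of_eventuallyEq_floor
      (f := fun n x => lam (x - n) + ε * ((1 - a ^ (3 * n)) / (1 - a ^ 3)) * α (x - n) ^ 3)
      (fun n => ?_) hΛ fun n => ?_
    · have hsub : ContDiff ℝ (⊤ : ℕ∞) fun x : ℝ => x - n := contDiff_id.sub contDiff_const
      exact (hlam.comp hsub).add (contDiff_const.mul ((hα.comp hsub).pow 3))
    · have h0 : Filter.Tendsto (fun x : ℝ => x - n) (nhds (n : ℝ)) (nhds 0) :=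
        (continuous_id.sub continuous_const).tendsto' _ _ (sub_self _)
      have h1 : Filter.Tendsto (fun x : ℝ => x - (n - 1 : ℤ)) (nhds (n : ℝ)) (nhds 1) :=
        (continuous_id.sub continuous_const).tendsto' _ _ (by simp)
      filter_upwards [h0.eventually hα0, h0.eventually hlam0, h1.eventually hα1,
        h1.eventually hlam1] with x hx0 hy0 hx1 hy1
      have hn := hpow (n - 1)
      rw [sub_add_cancel] at hn
      simp only [hx0, hy0, hx1, hy1, hn]
      field_simp
      ring
  · intro x
    have hfract : x + 1 - (⌊x⌋ + 1 : ℤ) = x - ⌊x⌋ := by push_cast; ring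
    have hcube : (a ^ ⌊x⌋) ^ 3 = a ^ (3 * ⌊x⌋) := by
      rw [mul_comm, zpow_mul]
      norm_cast
    rw [hΛ, hΛ, hA, Int.floor_add_one, hfract, hpow, mul_pow, hcube]
    field_simp
    ring
end

section
/- Fix real numbers a > 1, m > 0 and ε with 0 < ε < (a³−1)/(m·a³). Let α : ℝ → ℝ satisfy 1 ≤ α(x) ≤ a for all x ∈ [0,1] and λ : ℝ → ℝ satisfy 0 ≤ λ(x) ≤ ε for all x ∈ [0,1]. Define Λ(x) = λ(x − ⌊x⌋) + ε · ((1 − a^{3⌊x⌋})/(1 − a³)) · α(x − ⌊x⌋)³. Then Λ(x) > −1/m for every real x; consequently, for every function f : ℝ → ℝ with 0 ≤ f(x) ≤ m for all x, one has 1 + Λ(x)·f(x) > 0 for all x. -/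
theorem parameter_function_lower_bound (a m ε : ℝ) (ha : 1 < a) (hm : 0 < m)
    (hε : 0 < ε) (hε' : ε < (a ^ 3 - 1) / (m * a ^ 3)) (α lam : ℝ → ℝ)
    (hα : ∀ x ∈ Set.Icc (0 : ℝ) 1, 1 ≤ α x ∧ α x ≤ a)
    (hlam : ∀ x ∈ Set.Icc (0 : ℝ) 1, 0 ≤ lam x ∧ lam x ≤ ε)
    (Λ : ℝ → ℝ)
    (hΛ : ∀ x : ℝ,
      Λ x = lam (x - ⌊x⌋) + ε * ((1 - a ^ (3 * ⌊x⌋ : ℤ)) / (1 - a ^ 3)) * (α (x - ⌊x⌋)) ^ 3) :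
    (∀ x : ℝ, Λ x > -1 / m) ∧
      ∀ f : ℝ → ℝ, (∀ x : ℝ, 0 ≤ f x ∧ f x ≤ m) → ∀ x : ℝ, 1 + Λ x * f x > 0 := by
  have hA : 1 < a ^ 3 := one_lt_pow₀ ha (by norm_num)
  have hεm : ε * (m * a ^ 3) < a ^ 3 - 1 := (lt_div_iff₀ (by positivity)).mp hε'
  have bound : ∀ x : ℝ, -1 / m < Λ x := by
    intro x
    have hmem : x - ⌊x⌋ ∈ Set.Icc (0 : ℝ) 1 :=
      ⟨Int.fract_nonneg x, (Int.fract_lt_one x).le⟩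
    obtain ⟨hα1, hαa⟩ := hα _ hmem
    have hαpos : 0 < α (x - ⌊x⌋) ^ 3 := by positivity
    have hαle : α (x - ⌊x⌋) ^ 3 ≤ a ^ 3 := by gcongr
    have hq : 0 < a ^ (3 * ⌊x⌋ : ℤ) := zpow_pos (by linarith) _
    rw [hΛ x]
    generalize a ^ (3 * ⌊x⌋ : ℤ) = q at hq ⊢
    generalize α (x - ⌊x⌋) ^ 3 = β at hαpos hαle ⊢
    have hneg : ε * ((1 - q) / (1 - a ^ 3)) * β = ε * (q - 1) * β / (a ^ 3 - 1) := by
      rw [← neg_sub q 1, ← neg_sub (a ^ 3) 1, neg_div_neg_eq]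
      ring
    have hlt : -1 / m < ε * (q - 1) * β / (a ^ 3 - 1) := by
      rw [div_lt_div_iff₀ hm (by linarith)]
      have hpos : 0 < ε * m * β * q := by positivity
      have hle : ε * m * β ≤ ε * m * a ^ 3 := by gcongr
      linarith
    rw [hneg]
    linarith [(hlam _ hmem).1]
  refine ⟨bound, fun f hf x => ?_⟩
  obtain ⟨hf0, hfm⟩ := hf x
  have hΛm : -1 < Λ x * m := (div_lt_iff₀ hm).mp (bound x)
  rcases le_total 0 (Λ x) with h | h
  · positivity
  · linarith [mul_le_mul_of_nonpos_left hfm h]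
end

section
/- Define x : ℝ → ℝ by x(t) = arcsin(√(cosh²t/(2cosh²t − 1))) for t ≤ 0 and x(t) = π − arcsin(√(cosh²t/(2cosh²t − 1))) for t ≥ 0 (both formulas give π/2 at t = 0, so x is well defined). Then x is continuous, strictly increasing, satisfies sin²(x(t))·(2cosh²t − 1) = cosh²t for all t, and maps ℝ bijectively onto the open interval (π/4, 3π/4). -/
open Real

/-- The change-of-variable function of Theorem 2.6 of the paper. -/
noncomputable def xfun (t : ℝ) : ℝ :=
  if t ≤ 0 then arcsin (Real.sqrt (cosh t ^ 2 / (2 * cosh t ^ 2 - 1)))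
  else π - arcsin (Real.sqrt (cosh t ^ 2 / (2 * cosh t ^ 2 - 1)))

theorem tanh_mem_Ioo (t : ℝ) : tanh t ∈ Set.Ioo (-1 : ℝ) 1 :=
  tanh_bijOn.mapsTo (Set.mem_univ t)

theorem strictMono_tanh : StrictMono tanh := fun s t h => by
  rw [← artanh_lt_artanh_iff (tanh_mem_Ioo s) (tanh_mem_Ioo t)]
  simpa only [artanh_tanh] using h

theorem continuous_real_tanh : Continuous tanh := by
  have h : tanh = fun t => sinh t / cosh t := funext tanh_eq_sinh_div_cosh
  rw [h]
  exact continuous_sinh.div continuous_cosh fun t => (cosh_pos t).ne'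

theorem cos_sq_arctan_tanh (t : ℝ) :
    cos (arctan (tanh t)) ^ 2 = cosh t ^ 2 / (2 * cosh t ^ 2 - 1) := by
  have hc := cosh_pos t
  have hs : sinh t ^ 2 = cosh t ^ 2 - 1 := by linarith [cosh_sq t]
  have h : 1 + (sinh t / cosh t) ^ 2 = (2 * cosh t ^ 2 - 1) / cosh t ^ 2 := by
    rw [div_pow, hs]
    field_simp
    ring
  rw [cos_sq_arctan, tanh_eq_sinh_div_cosh, h, one_div_div]

theorem sqrt_cosh_sq_div (t : ℝ) :
    √(cosh t ^ 2 / (2 * cosh t ^ 2 - 1)) = cos (arctan (tanh t)) := by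
  rw [← cos_sq_arctan_tanh, sqrt_sq (cos_arctan_pos _).le]

theorem xfun_eq (t : ℝ) : xfun t = π / 2 + arctan (tanh t) := by
  have h₁ := neg_pi_div_two_lt_arctan (tanh t)
  have h₂ := arctan_lt_pi_div_two (tanh t)
  have h₀ : arctan (tanh 0) = 0 := by simp
  have hmono := arctan_strictMono.comp strictMono_tanh
  unfold xfun
  rw [sqrt_cosh_sq_div]
  split_ifs with ht
  · have : arctan (tanh t) ≤ arctan (tanh 0) := hmono.monotone ht
    rw [← sin_add_pi_div_two, arcsin_sin] <;> linarith
  · have : arctan (tanh 0) ≤ arctan (tanh t) := hmono.monotone (not_le.mp ht).le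
    rw [← sin_pi_div_two_sub, arcsin_sin] <;> linarith

theorem xfun_properties :
    Continuous xfun ∧ StrictMono xfun ∧
      (∀ t : ℝ, sin (xfun t) ^ 2 * (2 * cosh t ^ 2 - 1) = cosh t ^ 2) ∧
      Set.BijOn xfun Set.univ (Set.Ioo (π / 4) (3 * π / 4)) := by
  have hx : xfun = fun t => π / 2 + arctan (tanh t) := funext xfun_eq
  have hmono : StrictMono xfun := by
    rw [hx]
    exact (arctan_strictMono.comp strictMono_tanh).const_add _
  refine ⟨?_, hmono, fun t => ?_, fun t _ => ?_, hmono.injective.injOn, fun y hy => ?_⟩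
  · rw [hx]
    exact continuous_const.add (continuous_arctan.comp continuous_real_tanh)
  · have h : 2 * cosh t ^ 2 - 1 ≠ 0 := by nlinarith [one_le_cosh t]
    rw [xfun_eq, add_comm, sin_add_pi_div_two, cos_sq_arctan_tanh, div_mul_cancel₀ _ h]
  · obtain ⟨h₁, h₂⟩ := tanh_mem_Ioo t
    have h₃ := arctan_strictMono h₁
    have h₄ := arctan_strictMono h₂
    rw [arctan_neg, arctan_one] at h₃
    rw [arctan_one] at h₄
    rw [xfun_eq]
    constructor <;> linarith
  · obtain ⟨h₁, h₂⟩ := hy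
    have hπ := pi_pos
    have ha : arctan (tan (y - π / 2)) = y - π / 2 :=
      arctan_tan (by linarith) (by linarith)
    have hmem : tan (y - π / 2) ∈ Set.Ioo (-1 : ℝ) 1 := by
      constructor <;> rw [← arctan_strictMono.lt_iff_lt, ha]
      · rw [arctan_neg, arctan_one]
        linarith
      · rw [arctan_one]
        linarith
    exact ⟨artanh (tan (y - π / 2)), Set.mem_univ _, by
      rw [xfun_eq, tanh_artanh hmem, ha]
      ring⟩
end

section
/- Define x : ℝ → ℝ by x(t) = arcsin(√(cosh²t/(2cosh²t − 1))) for t ≤ 0 and x(t) = π − arcsin(√(cosh²t/(2cosh²t − 1))) for t ≥ 0 (both formulas give π/2 at t = 0, so x is well defined). Then x is C^∞ on all of ℝ (including at t = 0). -/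
open Real

/-- The square-root branch in closed form, for `u = |sinh t / cosh t|`. -/
lemma arcsin_sqrt_cosh_eq {t u : ℝ} (hu : 0 ≤ u) (h : u ^ 2 = (sinh t / cosh t) ^ 2) :
    arcsin (Real.sqrt (cosh t ^ 2 / (2 * cosh t ^ 2 - 1))) = π / 2 - arctan u := by
  have hc : cosh t ≠ 0 := (cosh_pos t).ne'
  have key : cosh t ^ 2 / (2 * cosh t ^ 2 - 1) = (1 + u ^ 2)⁻¹ := by
    have hs : 1 + u ^ 2 = (2 * cosh t ^ 2 - 1) / cosh t ^ 2 := by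
      rw [h, div_pow, sinh_sq]
      field_simp
      ring
    rw [hs, inv_div]
  rw [key, Real.sqrt_inv, arctan_eq_arccos hu, arccos]
  ring

lemma xfun_eq_arctan (t : ℝ) : xfun t = π / 2 + arctan (sinh t / cosh t) := by
  unfold xfun
  split_ifs with ht
  · have hu : 0 ≤ -(sinh t / cosh t) :=
      neg_nonneg.2 (div_nonpos_of_nonpos_of_nonneg (sinh_nonpos_iff.2 ht) (cosh_pos t).le)
    rw [arcsin_sqrt_cosh_eq hu (neg_sq _), arctan_neg]
    ring
  · have hu : 0 ≤ sinh t / cosh t :=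
      div_nonneg (sinh_nonneg_iff.2 (not_le.1 ht).le) (cosh_pos t).le
    rw [arcsin_sqrt_cosh_eq hu rfl]
    ring

theorem xfun_smooth : ContDiff ℝ (⊤ : ℕ∞) xfun := by
  rw [funext xfun_eq_arctan]
  exact contDiff_const.add
    (contDiff_arctan.comp (contDiff_sinh.div contDiff_cosh fun t => (cosh_pos t).ne'))
end
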